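/- If C is a free E-linear code of length n, then LHull(C) = LHull(C^{⊥L}) and RHull(C) = LHull(C^{⊥R}). -/

import Mathlib

open scoped BigOperators

/-- The non-unital ring `E` of order 4: the pair `(u, v)` represents `uκ + vζ`,
where `ζ = κ + τ`.  Multiplication: `(uκ + vζ)·(u'κ + v'ζ) = u'·(uκ + vζ)`. -/
def RingE : Type := ZMod 2 × ZMod 2

namespace RingE

instance : AddCommGroup RingE := inferInstanceAs (AddCommGroup (ZMod 2 × ZMod 2))

instance : Mul RingE := ⟨fun a b => Prod.mk (Prod.fst a * Prod.fst b) (Prod.snd a * Prod.fst b)⟩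

noncomputable instance : DecidableEq RingE := Classical.decEq _

instance : NonUnitalRing RingE where
  left_distrib a b c := by
    show Prod.mk (Prod.fst a * (Prod.fst b + Prod.fst c))
        (Prod.snd a * (Prod.fst b + Prod.fst c)) = _
    show _ = Prod.mk (Prod.fst a * Prod.fst b + Prod.fst a * Prod.fst c)
        (Prod.snd a * Prod.fst b + Prod.snd a * Prod.fst c)
    simp [mul_add]
  right_distrib a b c := by
    show Prod.mk ((Prod.fst a + Prod.fst b) * Prod.fst c)
        ((Prod.snd a + Prod.snd b) * Prod.fst c) = _
    show _ = Prod.mk (Prod.fst a * Prod.fst c + Prod.fst b * Prod.fst c)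
        (Prod.snd a * Prod.fst c + Prod.snd b * Prod.fst c)
    simp [add_mul]
  zero_mul a := by
    show Prod.mk ((0 : ZMod 2) * Prod.fst a) ((0 : ZMod 2) * Prod.fst a) = ((0 : ZMod 2), (0 : ZMod 2))
    simp
  mul_zero a := by
    show Prod.mk (Prod.fst a * (0 : ZMod 2)) (Prod.snd a * (0 : ZMod 2)) = ((0 : ZMod 2), (0 : ZMod 2))
    simp
  mul_assoc a b c := by
    show Prod.mk (Prod.fst a * Prod.fst b * Prod.fst c) (Prod.snd a * Prod.fst b * Prod.fst c)
      = Prod.mk (Prod.fst a * (Prod.fst b * Prod.fst c)) (Prod.snd a * (Prod.fst b * Prod.fst c))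
    simp [mul_assoc]

/-- The generator `κ`. -/
def kappa : RingE := Prod.mk 1 0

/-- The generator `τ`. -/
def tau : RingE := Prod.mk 1 1

/-- `ζ = κ + τ`. -/
def zeta : RingE := Prod.mk 0 1

/-- The reduction map `π : E → F₂`, sending `uκ + vζ` to `u`. -/
def pi (a : RingE) : ZMod 2 := Prod.fst a

/-- `κ·c` for a scalar `c ∈ F₂`, i.e. the element `cκ` of `E`. -/
def kappaSMul (c : ZMod 2) : RingE := Prod.mk c 0

/-- `ζ·c` for a scalar `c ∈ F₂`, i.e. the element `cζ` of `E`. -/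
def zetaSMul (c : ZMod 2) : RingE := Prod.mk 0 c

end RingE

namespace ECode

/-- Componentwise reduction `π : Eⁿ → F₂ⁿ`. -/
def piVec {n : ℕ} (x : Fin n → RingE) : Fin n → ZMod 2 := fun i => RingE.pi (x i)

/-- The vector `κv ∈ Eⁿ` attached to `v ∈ F₂ⁿ`. -/
def kappaVec {n : ℕ} (v : Fin n → ZMod 2) : Fin n → RingE := fun i => RingE.kappaSMul (v i)

/-- The vector `ζv ∈ Eⁿ` attached to `v ∈ F₂ⁿ`. -/
def zetaVec {n : ℕ} (v : Fin n → ZMod 2) : Fin n → RingE := fun i => RingE.zetaSMul (v i)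

/-- An `E`-linear code of length `n`: a left `E`-submodule of `Eⁿ`, i.e. an additive
subgroup closed under componentwise left multiplication by elements of `E`. -/
def IsECode {n : ℕ} (C : Set (Fin n → RingE)) : Prop :=
  (0 : Fin n → RingE) ∈ C ∧ (∀ x ∈ C, ∀ y ∈ C, x + y ∈ C) ∧ (∀ x ∈ C, -x ∈ C) ∧
    ∀ (a : RingE), ∀ x ∈ C, (fun i => a * x i) ∈ C

/-- The residue code `C_Res = π(C)`. -/
def Res {n : ℕ} (C : Set (Fin n → RingE)) : Set (Fin n → ZMod 2) := piVec '' C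

/-- The torsion code `C_Tor = {v ∈ F₂ⁿ : ζv ∈ C}`. -/
def Tor {n : ℕ} (C : Set (Fin n → RingE)) : Set (Fin n → ZMod 2) := {v | zetaVec v ∈ C}

/-- A code is free if its residue and torsion codes coincide. -/
def IsFree {n : ℕ} (C : Set (Fin n → RingE)) : Prop := Res C = Tor C

/-- The inner product on `Eⁿ`. -/
def Einner {n : ℕ} (w z : Fin n → RingE) : RingE := ∑ i, w i * z i

/-- The left dual `C^{⊥L}`. -/
def dualL {n : ℕ} (C : Set (Fin n → RingE)) : Set (Fin n → RingE) :=
  {z | ∀ w ∈ C, Einner z w = 0}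

/-- The right dual `C^{⊥R}`. -/
def dualR {n : ℕ} (C : Set (Fin n → RingE)) : Set (Fin n → RingE) :=
  {z | ∀ w ∈ C, Einner w z = 0}

/-- The (two-sided) dual `C^⊥ = C^{⊥L} ∩ C^{⊥R}`. -/
def dualE {n : ℕ} (C : Set (Fin n → RingE)) : Set (Fin n → RingE) := dualL C ∩ dualR C

/-- The left hull `LHull(C) = C ∩ C^{⊥L}`. -/
def LHull {n : ℕ} (C : Set (Fin n → RingE)) : Set (Fin n → RingE) := C ∩ dualL C

/-- The right hull `RHull(C) = C ∩ C^{⊥R}`. -/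
def RHull {n : ℕ} (C : Set (Fin n → RingE)) : Set (Fin n → RingE) := C ∩ dualR C

/-- The hull `Hull(C) = C ∩ C^⊥`. -/
def EHull {n : ℕ} (C : Set (Fin n → RingE)) : Set (Fin n → RingE) := C ∩ dualE C

/-- The Euclidean inner product on `F₂ⁿ`. -/
def Finner {n : ℕ} (w z : Fin n → ZMod 2) : ZMod 2 := ∑ i, w i * z i

/-- The Euclidean dual of an `F₂`-linear code. -/
def dualF {n : ℕ} (B : Set (Fin n → ZMod 2)) : Set (Fin n → ZMod 2) :=
  {z | ∀ w ∈ B, Finner w z = 0}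

/-- The hull of an `F₂`-linear code. -/
def FHull {n : ℕ} (B : Set (Fin n → ZMod 2)) : Set (Fin n → ZMod 2) := B ∩ dualF B

/-- `F₂`-dimension of an `F₂`-linear code (as the dimension of its span). -/
noncomputable def dimF {n : ℕ} (B : Set (Fin n → ZMod 2)) : ℕ :=
  Module.finrank (ZMod 2) (Submodule.span (ZMod 2) B)

/-- Scalar multiplication of a vector of `Eⁿ` by `a ∈ E`. -/
def smulVec {n : ℕ} (a : RingE) (x : Fin n → RingE) : Fin n → RingE := fun i => a * x i

/-- The left `E`-span `⟨X⟩_E` of a finite set `X ⊆ Eⁿ`. -/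
def spanE {n : ℕ} (X : Finset (Fin n → RingE)) : Set (Fin n → RingE) :=
  {y | ∃ c : (Fin n → RingE) → RingE, y = ∑ x ∈ X, smulVec (c x) x}

/-- The additive (`F₂`-) span `⟨X⟩_{F₂}` of a finite set `X ⊆ Eⁿ`: all sums of subsets. -/
def spanF {n : ℕ} (X : Finset (Fin n → RingE)) : Set (Fin n → RingE) :=
  {y | ∃ S : Finset (Fin n → RingE), S ⊆ X ∧ y = ∑ x ∈ S, x}

/-- `X` is a generating set of the code `D` if `⟨X⟩_E ∪ ⟨X⟩_{F₂} = D`. -/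
def IsGenSet {n : ℕ} (X : Finset (Fin n → RingE)) (D : Set (Fin n → RingE)) : Prop :=
  spanE X ∪ spanF X = D

/-- The rank of a (free) code: the minimum cardinality of a generating set. -/
noncomputable def genRank {n : ℕ} (D : Set (Fin n → RingE)) : ℕ :=
  sInf {m | ∃ X : Finset (Fin n → RingE), X.card = m ∧ IsGenSet X D}

/-- Prepending two coordinates to a vector of length `n`. -/
def cons2 {n : ℕ} (a b : RingE) (x : Fin n → RingE) : Fin (n + 2) → RingE :=
  Fin.cons a (Fin.cons b x)

end ECode

namespace ECode

/-- Componentwise `ζ`-part of a vector. -/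
def sndVec {n : ℕ} (x : Fin n → RingE) : Fin n → ZMod 2 := fun i => Prod.snd (x i)

theorem vec_ext {n : ℕ} {x y : Fin n → RingE} (h1 : piVec x = piVec y)
    (h2 : sndVec x = sndVec y) : x = y := by
  funext i
  exact Prod.ext (congrFun h1 i) (congrFun h2 i)

/-- First projection as an additive hom. -/
def fstHom : RingE →+ ZMod 2 := AddMonoidHom.fst (ZMod 2) (ZMod 2)

/-- Second projection as an additive hom. -/
def sndHom : RingE →+ ZMod 2 := AddMonoidHom.snd (ZMod 2) (ZMod 2)

theorem fst_inner {n : ℕ} (w z : Fin n → RingE) :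
    fstHom (Einner w z) = Finner (piVec w) (piVec z) := by
  unfold Einner
  rw [map_sum]
  rfl

theorem snd_inner {n : ℕ} (w z : Fin n → RingE) :
    sndHom (Einner w z) = Finner (sndVec w) (piVec z) := by
  unfold Einner
  rw [map_sum]
  rfl

theorem inner_eq_zero {n : ℕ} (w z : Fin n → RingE) :
    Einner w z = 0 ↔ Finner (piVec w) (piVec z) = 0 ∧ Finner (sndVec w) (piVec z) = 0 := by
  rw [← fst_inner, ← snd_inner]
  constructor
  · intro h
    rw [h]
    exact ⟨map_zero _, map_zero _⟩
  · rintro ⟨h1, h2⟩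
    exact Prod.ext h1 h2

theorem finner_comm {n : ℕ} (w z : Fin n → ZMod 2) : Finner w z = Finner z w := by
  unfold Finner
  exact Finset.sum_congr rfl fun i _ => mul_comm _ _

theorem finner_zero {n : ℕ} (w : Fin n → ZMod 2) : Finner w 0 = 0 := by
  simp [Finner]

theorem double_dual {n : ℕ} (B : Submodule (ZMod 2) (Fin n → ZMod 2)) (x : Fin n → ZMod 2)
    (h : ∀ y, (∀ b ∈ B, Finner b y = 0) → Finner x y = 0) : x ∈ B := by
  by_contra hx
  obtain ⟨f, hf, hB⟩ := Submodule.exists_le_ker_of_notMem hx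
  have key : ∀ z, f z = Finner z (fun i => f (Pi.single i 1)) := by
    intro z
    conv_lhs => rw [pi_eq_sum_univ' z]
    rw [map_sum]
    unfold Finner
    refine Finset.sum_congr rfl fun i _ => ?_
    rw [map_smul, smul_eq_mul]
  apply hf
  rw [key]
  apply h
  intro b hb
  rw [← key]
  exact hB hb

/-- The residue code as a submodule. -/
def torSub {n : ℕ} (C : Set (Fin n → RingE)) (hC : IsECode C) :
    Submodule (ZMod 2) (Fin n → ZMod 2) where
  carrier := Tor C
  zero_mem' := hC.1
  add_mem' := by
    intro a b ha hb
    have h := hC.2.1 _ ha _ hb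
    have e : zetaVec a + zetaVec b = zetaVec (a + b) := by
      apply vec_ext
      · funext i
        exact add_zero (0 : ZMod 2)
      · rfl
    rw [e] at h
    exact h
  smul_mem' := by
    intro c x hx
    have hc : c = 0 ∨ c = 1 := by
      revert c
      decide
    rcases hc with rfl | rfl
    · rw [zero_smul]
      exact hC.1
    · rw [one_smul]
      exact hx

theorem mem_code {n : ℕ} (C : Set (Fin n → RingE)) (hC : IsECode C) (hfree : IsFree C)
    (x : Fin n → RingE) :
    x ∈ C ↔ piVec x ∈ torSub C hC ∧ sndVec x ∈ torSub C hC := by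
  have hk : ∀ u, u ∈ torSub C hC → kappaVec u ∈ C := by
    intro u hu
    have hu' : u ∈ Res C := by
      rw [hfree]
      exact hu
    obtain ⟨y, hy, rfl⟩ := hu'
    have := hC.2.2.2 RingE.kappa y hy
    convert this using 1
    apply vec_ext
    · funext i
      exact (one_mul (Prod.fst (y i) : ZMod 2)).symm
    · funext i
      exact (zero_mul (Prod.fst (y i) : ZMod 2)).symm
  have hsum : x = kappaVec (piVec x) + zetaVec (sndVec x) := by
    apply vec_ext
    · funext i
      exact (add_zero (Prod.fst (x i) : ZMod 2)).symm
    · funext i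
      exact (zero_add (Prod.snd (x i) : ZMod 2)).symm
  constructor
  · intro hx
    have h1 : piVec x ∈ torSub C hC := by
      have : piVec x ∈ Res C := ⟨x, hx, rfl⟩
      rw [hfree] at this
      exact this
    refine ⟨h1, ?_⟩
    have h2 := hC.2.1 _ (hC.2.2.1 _ (hk _ h1)) _ hx
    have e : -kappaVec (piVec x) + x = zetaVec (sndVec x) := by
      rw [neg_add_eq_iff_eq_add]
      exact hsum
    rw [e] at h2
    exact h2
  · rintro ⟨h1, h2⟩
    rw [hsum]
    exact hC.2.1 _ (hk _ h1) _ h2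

/-- Vector from two components. -/
def mkVec {n : ℕ} (u v : Fin n → ZMod 2) : Fin n → RingE := fun i => Prod.mk (u i) (v i)

theorem mem_dualL {n : ℕ} (D : Set (Fin n → RingE)) (P : (Fin n → ZMod 2) → Prop)
    (h1 : ∀ x ∈ D, P (piVec x)) (h2 : ∀ u, P u → ∃ x ∈ D, piVec x = u)
    (z : Fin n → RingE) :
    z ∈ dualL D ↔ (∀ u, P u → Finner (piVec z) u = 0) ∧
      (∀ u, P u → Finner (sndVec z) u = 0) := by
  constructor
  · intro hz
    constructor
    · intro u hu
      obtain ⟨x, hx, rfl⟩ := h2 u hu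
      exact ((inner_eq_zero _ _).1 (hz x hx)).1
    · intro u hu
      obtain ⟨x, hx, rfl⟩ := h2 u hu
      exact ((inner_eq_zero _ _).1 (hz x hx)).2
  · rintro ⟨ha, hb⟩ x hx
    exact (inner_eq_zero _ _).2 ⟨ha _ (h1 x hx), hb _ (h1 x hx)⟩

theorem double_dual_iff {n : ℕ} (B : Submodule (ZMod 2) (Fin n → ZMod 2)) (x : Fin n → ZMod 2) :
    (∀ y, (∀ b ∈ B, Finner y b = 0) → Finner x y = 0) ↔ x ∈ B := by
  constructor
  · intro h
    apply double_dual
    intro y hy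
    apply h
    intro b hb
    rw [finner_comm]
    exact hy b hb
  · intro hx y hy
    rw [finner_comm]
    exact hy x hx

end ECode

open ECode in
/-- If `C` is free, then `LHull(C) = LHull(C^{⊥L})` and
`RHull(C) = LHull(C^{⊥R})`. -/
theorem hulls_of_duals {n : ℕ} (C : Set (Fin n → RingE)) (hC : IsECode C)
    (hfree : IsFree C) : LHull C = LHull (dualL C) ∧ RHull C = LHull (dualR C) := by
  have hm := mem_code C hC hfree
  set B := torSub C hC with hB
  have hL : ∀ z, z ∈ dualL C ↔ (∀ u, u ∈ B → Finner (piVec z) u = 0) ∧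
      (∀ u, u ∈ B → Finner (sndVec z) u = 0) :=
    mem_dualL C (fun u => u ∈ B) (fun x hx => ((hm x).1 hx).1)
      (fun u hu => ⟨mkVec u u, (hm _).2 ⟨hu, hu⟩, rfl⟩)
  have hR : ∀ z, z ∈ dualR C ↔ ∀ u, u ∈ B → Finner (piVec z) u = 0 := by
    intro z
    constructor
    · intro hz u hu
      rw [finner_comm]
      exact ((inner_eq_zero _ _).1 (hz (mkVec u u) ((hm _).2 ⟨hu, hu⟩))).1
    · intro hz x hx
      obtain ⟨h1, h2⟩ := (hm x).1 hx
      refine (inner_eq_zero _ _).2 ⟨?_, ?_⟩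
      · rw [finner_comm]
        exact hz _ h1
      · rw [finner_comm]
        exact hz _ h2
  have hLL : ∀ z, z ∈ dualL (dualL C) ↔ z ∈ C := by
    intro z
    rw [mem_dualL (dualL C) (fun y => ∀ b ∈ B, Finner y b = 0) (fun x hx => ((hL x).1 hx).1)
      (fun u hu => ⟨mkVec u u, (hL _).2 ⟨hu, hu⟩, rfl⟩), double_dual_iff, double_dual_iff, hm]
  have hLR : ∀ z, z ∈ dualL (dualR C) ↔ z ∈ C := by
    intro z
    rw [mem_dualL (dualR C) (fun y => ∀ b ∈ B, Finner y b = 0) (fun x hx => (hR x).1 hx)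
      (fun u hu => ⟨mkVec u u, (hR _).2 hu, rfl⟩), double_dual_iff, double_dual_iff, hm]
  constructor
  · ext z
    exact ⟨fun h => ⟨h.2, (hLL z).2 h.1⟩, fun h => ⟨(hLL z).1 h.2, h.1⟩⟩
  · ext z
    exact ⟨fun h => ⟨h.2, (hLR z).2 h.1⟩, fun h => ⟨(hLR z).1 h.2, h.1⟩⟩
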